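/- arXiv:2512.18060 — 5 statements merged into one kernel-verified Lean document; each statement's English description precedes it below -/
import Mathlib

section
/- Let G = (V, E, w) be a finite weighted graph with symmetric nonnegative weights, w(x,x) = 0 for all x, and weighted degrees deg(x) = Σ_{y∈V} w(x,y). Let p ∈ V be a vertex with deg(p) > 0, and define new weights on V∖{p} by w'(x,y) = w(x,y) + w(x,p)·w(p,y)/deg(p) for all x, y ∈ V∖{p} (self-loops x = y allowed), with new degrees deg'(x) = Σ_{y∈V∖{p}} w'(x,y). Then for every u, v ∈ V∖{p} with u ≠ v and deg(u) > 0, the one-step random-walk transition probability in the new graph equals the probability of going from u to v either directly or through p in the old graph: w'(u,v)/deg'(u) = w(u,v)/deg(u) + (w(u,p)/deg(u))·(w(p,v)/deg(p)). -/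
open Finset

/-- **Star-mesh transform preserves one-step random walk probabilities.**
For a finite weighted graph with symmetric nonnegative weights, zero diagonal, and
weighted degrees `deg x = ∑ y, w x y`, deleting a vertex `p` with `deg p > 0` via the
star-mesh transform `w' x y = w x y + w x p * w p y / deg p` (on `V \ {p}`, self-loops
allowed, with new degrees `deg' x = ∑_{y ≠ p} w' x y`) yields, for every `u ≠ v` in
`V \ {p}` with `deg u > 0`:
`w'(u,v)/deg'(u) = w(u,v)/deg(u) + (w(u,p)/deg(u)) * (w(p,v)/deg(p))`. -/
theorem star_mesh_transition_prob {V : Type*} [Fintype V] [DecidableEq V]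
    (w : V → V → ℝ)
    (hsymm : ∀ x y, w x y = w y x)
    (hnonneg : ∀ x y, 0 ≤ w x y)
    (hdiag : ∀ x, w x x = 0)
    (p : V)
    (hdegp : 0 < ∑ y, w p y)
    (w' : V → V → ℝ)
    (hw' : ∀ x y, x ≠ p → y ≠ p →
      w' x y = w x y + w x p * w p y / ∑ z, w p z)
    (u v : V) (hu : u ≠ p) (hv : v ≠ p) (huv : u ≠ v)
    (hdegu : 0 < ∑ y, w u y) :
    w' u v / (∑ y ∈ Finset.univ \ {p}, w' u y) =
      w u v / (∑ y, w u y) + (w u p / ∑ y, w u y) * (w p v / ∑ y, w p y) := by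
  have hdeg : ∑ y ∈ Finset.univ \ {p}, w' u y = ∑ y, w u y := by
    have hsplit : ∀ x, ∑ y ∈ Finset.univ \ {p}, w x y = ∑ y, w x y - w x p := by
      intro x
      rw [Finset.sum_sdiff_eq_sub (Finset.subset_univ _), Finset.sum_singleton]
    have hsum : ∑ y ∈ Finset.univ \ {p}, w' u y =
        ∑ y ∈ Finset.univ \ {p}, (w u y + w u p * w p y / ∑ z, w p z) :=
      Finset.sum_congr rfl fun y hy => hw' u y hu (by simpa using hy)
    rw [hsum, Finset.sum_add_distrib, ← Finset.sum_div, ← Finset.mul_sum, hsplit, hsplit,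
      hdiag, sub_zero, mul_div_cancel_right₀ _ hdegp.ne', sub_add_cancel]
  rw [hdeg, hw' u v hu hv, add_div]
  congr 1
  ring
end

section
/- Let C ∈ ℝ^{m×n} be a matrix with no zero rows and let p_i = ‖C_{i,*}‖₂² / ‖C‖_F². Let e(1),…,e(s) be i.i.d. random indices with Pr[e(j) = i] = p_i, set X_j = p_{e(j)}^{-1} · C_{e(j),*}ᵀ C_{e(j),*}, and Y = (1/s) Σ_{j=1}^{s} X_j. Then E[‖Y‖_F²] = ‖C‖_F⁴/s + ((s−1)/s)·‖CᵀC‖_F². -/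
open Finset Matrix

theorem sum_fin_succ_fun {ι M : Type*} [Fintype ι] [AddCommMonoid M] (s : ℕ)
    (F : (Fin (s + 1) → ι) → M) :
    ∑ f, F f = ∑ i, ∑ f : Fin s → ι, F (Fin.cons i f) := by
  rw [← Fintype.sum_prod_type']
  exact (Fintype.sum_equiv (Fin.consEquiv fun _ => ι) _ _ fun _ => rfl).symm

theorem sum_prod_weights {ι : Type*} [Fintype ι] (p : ι → ℝ) (hp : ∑ i, p i = 1) (s : ℕ) :
    ∑ f : Fin s → ι, ∏ j, p (f j) = 1 := by
  induction s with
  | zero => simp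
  | succ s ih =>
    rw [sum_fin_succ_fun]
    simp [Fin.prod_univ_succ, ← mul_sum, ih, hp]

/-- The mean of a sum of i.i.d. samples. -/
theorem sum_prod_weights_mul_sum {ι : Type*} [Fintype ι] (p g : ι → ℝ) (hp : ∑ i, p i = 1)
    (s : ℕ) :
    ∑ f : Fin s → ι, (∏ j, p (f j)) * ∑ j, g (f j) = s * ∑ i, p i * g i := by
  induction s with
  | zero => simp
  | succ s ih =>
    have key : ∀ i, ∑ f : Fin s → ι, (p i * ∏ j, p (f j)) * (g i + ∑ j, g (f j)) =
        p i * g i + p i * (s * ∑ i, p i * g i) := fun i => by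
      calc _ = p i * g i * ∑ f : Fin s → ι, ∏ j, p (f j) +
            p i * ∑ f : Fin s → ι, (∏ j, p (f j)) * ∑ j, g (f j) := by
            rw [mul_sum, mul_sum, ← sum_add_distrib]
            exact sum_congr rfl fun f _ => by ring
        _ = _ := by rw [ih, sum_prod_weights p hp, mul_one]
    rw [sum_fin_succ_fun]
    simp only [Fin.prod_univ_succ, Fin.sum_univ_succ, Fin.cons_zero, Fin.cons_succ, key]
    rw [sum_add_distrib, ← sum_mul, hp]
    push_cast
    ring

/-- The second moment of a sum of i.i.d. samples. -/
theorem sum_prod_weights_mul_sum_sq {ι : Type*} [Fintype ι] (p g : ι → ℝ)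
    (hp : ∑ i, p i = 1) (s : ℕ) :
    ∑ f : Fin s → ι, (∏ j, p (f j)) * (∑ j, g (f j)) ^ 2 =
      s * ∑ i, p i * g i ^ 2 + s * (s - 1) * (∑ i, p i * g i) ^ 2 := by
  induction s with
  | zero => simp
  | succ s ih =>
    have key : ∀ i, ∑ f : Fin s → ι, (p i * ∏ j, p (f j)) * (g i + ∑ j, g (f j)) ^ 2 =
        p i * g i ^ 2 + p i * g i * (2 * (s * ∑ i, p i * g i)) +
          p i * (s * ∑ i, p i * g i ^ 2 + s * (s - 1) * (∑ i, p i * g i) ^ 2) := fun i => by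
      calc _ = p i * g i ^ 2 * ∑ f : Fin s → ι, ∏ j, p (f j) +
            p i * g i * (2 * ∑ f : Fin s → ι, (∏ j, p (f j)) * ∑ j, g (f j)) +
            p i * ∑ f : Fin s → ι, (∏ j, p (f j)) * (∑ j, g (f j)) ^ 2 := by
            simp only [mul_sum (s := (univ : Finset (Fin s → ι))), ← sum_add_distrib]
            exact sum_congr rfl fun f _ => by ring
        _ = _ := by
            rw [ih, sum_prod_weights p hp, sum_prod_weights_mul_sum p g hp, mul_one]
    rw [sum_fin_succ_fun]
    simp only [Fin.prod_univ_succ, Fin.sum_univ_succ, Fin.cons_zero, Fin.cons_succ, key]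
    rw [sum_add_distrib, sum_add_distrib, ← sum_mul, ← sum_mul, hp]
    push_cast
    ring

/-- **Second moment of the averaged i.i.d. row-norm sampling estimator.**
Let `C ∈ ℝ^{m×n}` have no zero rows and `p i = ‖C_{i,*}‖₂² / ‖C‖_F²`. Draw i.i.d.
indices `e(1), …, e(s)` with `Pr[e(j) = i] = p i` (the joint distribution of the
sample sequence `f : Fin s → Fin m` has mass `∏ j, p (f j)`), set
`X_j = p_{e(j)}⁻¹ • C_{e(j),*}ᵀ C_{e(j),*}` and `Y = (1/s) ∑ j, X_j`. Then
`E[‖Y‖_F²] = ‖C‖_F⁴ / s + ((s-1)/s) * ‖CᵀC‖_F²`. -/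
theorem iid_row_sampling_second_moment {m n : ℕ} (C : Matrix (Fin m) (Fin n) ℝ)
    (hrows : ∀ i, C i ≠ 0)
    (p : Fin m → ℝ)
    (hp : ∀ i, p i = (∑ j, C i j ^ 2) / (∑ i', ∑ j, C i' j ^ 2))
    (s : ℕ) (hs : 0 < s)
    (Y : (Fin s → Fin m) → Matrix (Fin n) (Fin n) ℝ)
    (hY : ∀ f, Y f = (s : ℝ)⁻¹ •
      ∑ j, (p (f j))⁻¹ • Matrix.vecMulVec (C (f j)) (C (f j))) :
    ∑ f : Fin s → Fin m, (∏ j, p (f j)) * (∑ a, ∑ b, (Y f a b) ^ 2) =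
      (∑ i, ∑ j, C i j ^ 2) ^ 2 / s +
        ((s : ℝ) - 1) / s * (∑ a, ∑ b, ((Cᵀ * C) a b) ^ 2) := by
  have hr : ∀ i, 0 < ∑ j, C i j ^ 2 := fun i => by
    obtain ⟨j, hj⟩ := Function.ne_iff.mp (hrows i)
    exact sum_pos' (fun _ _ => sq_nonneg _) ⟨j, mem_univ j, by have : C i j ≠ 0 := hj; positivity⟩
  have hs' : (s : ℝ) ≠ 0 := by positivity
  rcases isEmpty_or_nonempty (Fin m) with hm | hm
  · have : Nonempty (Fin s) := ⟨⟨0, hs⟩⟩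
    simp [Matrix.mul_apply]
  have hF : 0 < ∑ i, ∑ j, C i j ^ 2 := sum_pos (fun i _ => hr i) univ_nonempty
  have hp1 : ∑ i, p i = 1 := by
    simp only [hp, ← sum_div]
    exact div_self hF.ne'
  have hp0 : ∀ i, p i ≠ 0 := fun i => by
    rw [hp]
    exact (div_pos (hr i) hF).ne'
  have hentry : ∀ f a b, Y f a b = (s : ℝ)⁻¹ * ∑ j, (p (f j))⁻¹ * (C (f j) a * C (f j) b) :=
    fun f a b => by simp [hY, Matrix.sum_apply, Matrix.vecMulVec_apply]
  have hmean : ∀ a b, ∑ i, p i * ((p i)⁻¹ * (C i a * C i b)) = (Cᵀ * C) a b := fun a b => by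
    simp [Matrix.mul_apply, mul_inv_cancel_left₀ (hp0 _)]
  have hsecond : ∑ a, ∑ b, ∑ i, p i * ((p i)⁻¹ * (C i a * C i b)) ^ 2 =
      (∑ i, ∑ j, C i j ^ 2) ^ 2 := by
    calc _ = ∑ i, (p i)⁻¹ * ((∑ a, C i a ^ 2) * ∑ b, C i b ^ 2) := by
          simp only [sum_mul_sum]
          simp only [mul_sum]
          rw [sum_congr rfl fun a _ => sum_comm, sum_comm]
          refine sum_congr rfl fun i _ => sum_congr rfl fun a _ => sum_congr rfl fun b _ => ?_
          have := hp0 i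
          field_simp
      _ = ∑ i, (∑ i', ∑ j, C i' j ^ 2) * ∑ j, C i j ^ 2 := by
          refine sum_congr rfl fun i _ => ?_
          have := (hr i).ne'
          rw [hp, inv_div]
          field_simp
      _ = _ := by rw [← mul_sum, sq]
  have hmoment : ∀ a b, ∑ f : Fin s → Fin m, (∏ j, p (f j)) * Y f a b ^ 2 =
      (s : ℝ)⁻¹ * ∑ i, p i * ((p i)⁻¹ * (C i a * C i b)) ^ 2 +
        ((s : ℝ) - 1) / s * (Cᵀ * C) a b ^ 2 := fun a b => by
    have h := sum_prod_weights_mul_sum_sq p (fun i => (p i)⁻¹ * (C i a * C i b)) hp1 s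
    rw [hmean] at h
    simp only [hentry, mul_pow _ _ 2, mul_left_comm _ ((s : ℝ)⁻¹ ^ 2), ← mul_sum] at h ⊢
    rw [h]
    field_simp
  calc _ = ∑ a, ∑ b, ∑ f : Fin s → Fin m, (∏ j, p (f j)) * Y f a b ^ 2 := by
        simp only [mul_sum]
        rw [sum_comm]
        exact sum_congr rfl fun a _ => sum_comm
    _ = _ := by
        simp only [hmoment, sum_add_distrib, ← mul_sum]
        rw [hsecond]
        ring
end

section
/- Let C ∈ ℝ^{m×n} be a matrix with no zero rows and let p_i = ‖C_{i,*}‖₂² / ‖C‖_F². Let e(1),…,e(s) be i.i.d. random indices with Pr[e(j) = i] = p_i, set X_j = p_{e(j)}^{-1} · C_{e(j),*}ᵀ C_{e(j),*}, and Y = (1/s) Σ_{j=1}^{s} X_j. Then E[‖Y − CᵀC‖_F²] ≤ ‖C‖_F⁴ / s. -/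
open Finset Matrix

/-- Summing over sequences of length `k + 1` by splitting off the first entry. -/
lemma sum_fin_succ_arrow {α : Type*} [Fintype α] (k : ℕ) (F : (Fin (k + 1) → α) → ℝ) :
    ∑ f, F f = ∑ a : α, ∑ g : Fin k → α, F (Fin.cons a g) := by
  rw [← (Fin.consEquiv fun _ : Fin (k + 1) => α).sum_comp, Fintype.sum_prod_type]
  rfl

/-- The product of `s` copies of a probability weight has total mass one. -/
lemma sum_prod_weight {α : Type*} [Fintype α] (p : α → ℝ) (hp : ∑ i, p i = 1) (s : ℕ) :
    ∑ f : Fin s → α, ∏ j, p (f j) = 1 := by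
  induction s with
  | zero => simp
  | succ k ih =>
    rw [sum_fin_succ_arrow]
    simp [Fin.prod_univ_succ, ← Finset.mul_sum, ih, hp]

/-- The sum of i.i.d. centered variables is centered. -/
lemma sum_prod_weight_mul_sum {α : Type*} [Fintype α] (p g : α → ℝ) (hp : ∑ i, p i = 1)
    (hg : ∑ i, p i * g i = 0) (s : ℕ) :
    ∑ f : Fin s → α, (∏ j, p (f j)) * ∑ j, g (f j) = 0 := by
  induction s with
  | zero => simp
  | succ k ih =>
    rw [sum_fin_succ_arrow]
    have h (a : α) (f : Fin k → α) : (p a * ∏ j, p (f j)) * (g a + ∑ j, g (f j)) =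
        (p a * g a) * ∏ j, p (f j) + p a * ((∏ j, p (f j)) * ∑ j, g (f j)) := by ring
    simp only [Fin.prod_univ_succ, Fin.sum_univ_succ, Fin.cons_zero, Fin.cons_succ, h,
      Finset.sum_add_distrib, ← Finset.mul_sum, ih, sum_prod_weight p hp]
    simp [hg]

/-- The variance of a sum of `s` i.i.d. centered variables is `s` times the common variance. -/
lemma sum_prod_weight_mul_sum_sq {α : Type*} [Fintype α] (p g : α → ℝ) (hp : ∑ i, p i = 1)
    (hg : ∑ i, p i * g i = 0) (s : ℕ) :
    ∑ f : Fin s → α, (∏ j, p (f j)) * (∑ j, g (f j)) ^ 2 = s * ∑ i, p i * g i ^ 2 := by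
  induction s with
  | zero => simp
  | succ k ih =>
    rw [sum_fin_succ_arrow]
    have h (a : α) (f : Fin k → α) : (p a * ∏ j, p (f j)) * (g a + ∑ j, g (f j)) ^ 2 =
        (p a * g a ^ 2) * ∏ j, p (f j) +
          (2 * p a * g a) * ((∏ j, p (f j)) * ∑ j, g (f j)) +
          p a * ((∏ j, p (f j)) * (∑ j, g (f j)) ^ 2) := by ring
    simp only [Fin.prod_univ_succ, Fin.sum_univ_succ, Fin.cons_zero, Fin.cons_succ, h,
      Finset.sum_add_distrib, ← Finset.mul_sum, ih, sum_prod_weight p hp,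
      sum_prod_weight_mul_sum p g hp hg, ← Finset.sum_mul, hp]
    push_cast
    simp
    ring

/-- The mean squared error of the average of `s` i.i.d. samples is at most the second moment
of one sample divided by `s`. -/
lemma sum_prod_weight_mul_average_sub_sq_le {α : Type*} [Fintype α] (p x : α → ℝ)
    (hp : ∑ i, p i = 1) (μ : ℝ) (hx : ∑ i, p i * x i = μ) (s : ℕ) (hs : 0 < s) :
    ∑ f : Fin s → α, (∏ j, p (f j)) * ((s : ℝ)⁻¹ * ∑ j, x (f j) - μ) ^ 2 ≤
      (s : ℝ)⁻¹ * ∑ i, p i * x i ^ 2 := by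
  have hs' : (s : ℝ) ≠ 0 := by positivity
  have hg : ∑ i, p i * (x i - μ) = 0 := by
    simp [mul_sub, Finset.sum_sub_distrib, ← Finset.sum_mul, hp, hx]
  have hvar : ∑ i, p i * (x i - μ) ^ 2 = ∑ i, p i * x i ^ 2 - μ ^ 2 := by
    have h (i : α) : p i * (x i - μ) ^ 2 =
        p i * x i ^ 2 - (2 * μ) * (p i * x i) + p i * μ ^ 2 := by ring
    simp only [h, Finset.sum_add_distrib, Finset.sum_sub_distrib, ← Finset.mul_sum,
      ← Finset.sum_mul, hx, hp]
    ring
  have hf (f : Fin s → α) : (∏ j, p (f j)) * ((s : ℝ)⁻¹ * ∑ j, x (f j) - μ) ^ 2 =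
      (s : ℝ)⁻¹ ^ 2 * ((∏ j, p (f j)) * (∑ j, (x (f j) - μ)) ^ 2) := by
    simp only [Finset.sum_sub_distrib, Finset.sum_const, Finset.card_univ, Fintype.card_fin,
      nsmul_eq_mul]
    field_simp
  calc _ = (s : ℝ)⁻¹ * ∑ i, p i * (x i - μ) ^ 2 := by
        simp only [hf, ← Finset.mul_sum]
        rw [sum_prod_weight_mul_sum_sq p _ hp hg]
        field_simp
    _ ≤ _ := by
        rw [hvar]
        gcongr
        linarith [sq_nonneg μ]

/-- **Mean squared Frobenius error of the averaged i.i.d. row-norm sampling estimator.**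
Let `C ∈ ℝ^{m×n}` have no zero rows and `p i = ‖C_{i,*}‖₂² / ‖C‖_F²`. Draw i.i.d.
indices `e(1), …, e(s)` with `Pr[e(j) = i] = p i` (the joint distribution of the
sample sequence `f : Fin s → Fin m` has mass `∏ j, p (f j)`), set
`X_j = p_{e(j)}⁻¹ • C_{e(j),*}ᵀ C_{e(j),*}` and `Y = (1/s) ∑ j, X_j`. Then
`E[‖Y − CᵀC‖_F²] ≤ ‖C‖_F⁴ / s`. -/
theorem iid_row_sampling_variance {m n : ℕ} (C : Matrix (Fin m) (Fin n) ℝ)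
    (hrows : ∀ i, C i ≠ 0)
    (p : Fin m → ℝ)
    (hp : ∀ i, p i = (∑ j, C i j ^ 2) / (∑ i', ∑ j, C i' j ^ 2))
    (s : ℕ) (hs : 0 < s)
    (Y : (Fin s → Fin m) → Matrix (Fin n) (Fin n) ℝ)
    (hY : ∀ f, Y f = (s : ℝ)⁻¹ •
      ∑ j, (p (f j))⁻¹ • Matrix.vecMulVec (C (f j)) (C (f j))) :
    ∑ f : Fin s → Fin m, (∏ j, p (f j)) *
        (∑ a, ∑ b, (Y f a b - (Cᵀ * C) a b) ^ 2) ≤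
      (∑ i, ∑ j, C i j ^ 2) ^ 2 / s := by
  rcases isEmpty_or_nonempty (Fin m) with hm | ⟨⟨i₀⟩⟩
  · have : Nonempty (Fin s) := ⟨⟨0, hs⟩⟩
    simp
  set F := ∑ i, ∑ j, C i j ^ 2 with hF
  have hrow (i : Fin m) : 0 < ∑ j, C i j ^ 2 := by
    obtain ⟨j, hj⟩ := Function.ne_iff.mp (hrows i)
    exact Finset.sum_pos' (fun _ _ => sq_nonneg _)
      ⟨j, Finset.mem_univ j, sq_pos_of_ne_zero hj⟩
  have hFpos : 0 < F := Finset.sum_pos (fun i _ => hrow i) ⟨i₀, Finset.mem_univ i₀⟩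
  have hppos (i : Fin m) : 0 < p i := by
    rw [hp]
    exact div_pos (hrow i) hFpos
  have hpsum : ∑ i, p i = 1 := by
    simp only [hp, ← Finset.sum_div]
    exact div_self hFpos.ne'
  have hentry (a b : Fin n) :
      ∑ f : Fin s → Fin m, (∏ j, p (f j)) * (Y f a b - (Cᵀ * C) a b) ^ 2 ≤
        (s : ℝ)⁻¹ * ∑ i, p i * ((p i)⁻¹ * (C i a * C i b)) ^ 2 := by
    have hmean : ∑ i, p i * ((p i)⁻¹ * (C i a * C i b)) = (Cᵀ * C) a b := by
      simp only [Matrix.mul_apply, Matrix.transpose_apply]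
      exact Finset.sum_congr rfl fun i _ => mul_inv_cancel_left₀ (hppos i).ne' _
    have hYab (f : Fin s → Fin m) :
        Y f a b = (s : ℝ)⁻¹ * ∑ j, (p (f j))⁻¹ * (C (f j) a * C (f j) b) := by
      simp [hY, Matrix.sum_apply, Matrix.vecMulVec_apply]
    simp only [hYab]
    exact sum_prod_weight_mul_average_sub_sq_le p _ hpsum _ hmean s hs
  have hmoment (i : Fin m) :
      ∑ a, ∑ b, p i * ((p i)⁻¹ * (C i a * C i b)) ^ 2 = F * ∑ j, C i j ^ 2 := by
    have h (a b : Fin n) : p i * ((p i)⁻¹ * (C i a * C i b)) ^ 2 =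
        (p i)⁻¹ * (C i a ^ 2 * C i b ^ 2) := by
      have := (hppos i).ne'
      field_simp
    simp only [h, ← Finset.mul_sum, ← Finset.sum_mul]
    rw [hp]
    have := (hrow i).ne'
    field_simp
  calc _ = ∑ a, ∑ b, ∑ f : Fin s → Fin m,
          (∏ j, p (f j)) * (Y f a b - (Cᵀ * C) a b) ^ 2 := by
        simp only [Finset.mul_sum]
        rw [Finset.sum_comm]
        exact Finset.sum_congr rfl fun a _ => Finset.sum_comm
    _ ≤ ∑ a, ∑ b, (s : ℝ)⁻¹ * ∑ i, p i * ((p i)⁻¹ * (C i a * C i b)) ^ 2 :=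
        Finset.sum_le_sum fun a _ => Finset.sum_le_sum fun b _ => hentry a b
    _ = (s : ℝ)⁻¹ * ∑ i, ∑ a, ∑ b, p i * ((p i)⁻¹ * (C i a * C i b)) ^ 2 := by
        simp_rw [Finset.mul_sum]
        rw [Finset.sum_comm (s := (Finset.univ : Finset (Fin m)))]
        exact Finset.sum_congr rfl fun a _ => Finset.sum_comm
    _ = F ^ 2 / s := by
        simp_rw [hmoment]
        rw [← Finset.mul_sum, ← hF]
        ring
end

section
/- Let G = (V, E, w) and G' = (V, E', w') be connected finite weighted graphs on the same n-vertex set with E' ⊆ E, with Laplacians L and L' whose kernels both equal the span of the all-ones vector. Suppose ‖L − L'‖_F ≤ δ and λ₂(L) ≥ μ for some μ > δ > 0. Then for every pair of distinct vertices u, v ∈ V, the effective resistances satisfy |R_G(u, v) − R_{G'}(u, v)| ≤ 4δ·(μ − δ)^{-2}. -/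
open Finset Matrix

/-- The bilinear form of a matrix is bounded by its Frobenius norm, in squared form. -/
theorem sq_sum_mul_mulVec_le {V : Type*} [Fintype V] (M : Matrix V V ℝ) (y z : V → ℝ) :
    (∑ a, y a * M.mulVec z a) ^ 2 ≤
      (∑ a, ∑ b, M a b ^ 2) * ((∑ a, y a ^ 2) * ∑ a, z a ^ 2) := by
  have hz : ∑ a, M.mulVec z a ^ 2 ≤ (∑ a, ∑ b, M a b ^ 2) * ∑ a, z a ^ 2 := by
    rw [Finset.sum_mul]
    exact Finset.sum_le_sum fun a _ => Finset.sum_mul_sq_le_sq_mul_sq Finset.univ (M a) z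
  calc (∑ a, y a * M.mulVec z a) ^ 2
      ≤ (∑ a, y a ^ 2) * ∑ a, M.mulVec z a ^ 2 :=
        Finset.sum_mul_sq_le_sq_mul_sq Finset.univ y (M.mulVec z)
    _ ≤ (∑ a, y a ^ 2) * ((∑ a, ∑ b, M a b ^ 2) * ∑ a, z a ^ 2) :=
        mul_le_mul_of_nonneg_left hz (Finset.sum_nonneg fun _ _ => sq_nonneg _)
    _ = _ := by ring

/-- Pairing a vector with `e_u - e_v` gives its potential difference. -/
theorem sum_mul_dipole {V : Type*} [Fintype V] [DecidableEq V] {u v : V} (huv : u ≠ v)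
    (x : V → ℝ) :
    ∑ z, x z * (if z = u then 1 else if z = v then -1 else 0) = x u - x v := by
  have h : ∀ z, x z * (if z = u then 1 else if z = v then -1 else 0) =
      (if z = u then x z else 0) - (if z = v then x z else 0) := by
    intro z
    by_cases hzu : z = u
    · simp [hzu, huv]
    · by_cases hzv : z = v <;> simp [hzu, hzv, huv.symm]
  simp [h, Finset.sum_sub_distrib]

/-- The square of a potential difference is at most twice the sum of squares. -/
theorem sq_sub_le_two_mul_sum_sq {V : Type*} [Fintype V] {u v : V} (huv : u ≠ v)
    (x : V → ℝ) : (x u - x v) ^ 2 ≤ 2 * ∑ z, x z ^ 2 := by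
  classical
  have h : ∑ z ∈ {u, v}, x z ^ 2 ≤ ∑ z, x z ^ 2 :=
    Finset.sum_le_sum_of_subset_of_nonneg (Finset.subset_univ _) fun _ _ _ => sq_nonneg _
  rw [Finset.sum_pair huv] at h
  nlinarith [sq_nonneg (x u + x v)]

/-- A coercivity constant `c` bounds the sum of squares of a dipole potential. -/
theorem sq_mul_sum_sq_le_two {V : Type*} [Fintype V] {u v : V} (huv : u ≠ v)
    (x : V → ℝ) {c : ℝ} (hc : 0 ≤ c) (h : c * ∑ z, x z ^ 2 ≤ x u - x v) :
    c ^ 2 * ∑ z, x z ^ 2 ≤ 2 := by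
  have hX : 0 ≤ ∑ z, x z ^ 2 := Finset.sum_nonneg fun _ _ => sq_nonneg _
  have hsq := sq_sub_le_two_mul_sum_sq huv x
  rcases hX.eq_or_lt with h0 | hpos
  · rw [← h0]
    norm_num
  · have hle : (c * ∑ z, x z ^ 2) ^ 2 ≤ (x u - x v) ^ 2 :=
      pow_le_pow_left₀ (mul_nonneg hc hX) h 2
    refine le_of_mul_le_mul_right ?_ hpos
    nlinarith

/-- **Effective resistance perturbation under Laplacian sparsification (Corollary of
the paper).**
Let `G = (V,E,w)` and `G' = (V,E',w')` be connected weighted graphs on the same finite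
vertex set with `E' ⊆ E` (every edge of `G'` is an edge of `G`), with Laplacians
`L = D − A` and `L' = D' − A'` whose kernels both equal the span of the all-ones
vector. The condition `λ₂(L) ≥ μ` is expressed equivalently as `μ‖v‖² ≤ vᵀLv` for all
sum-zero `v`. If `‖L − L'‖_F ≤ δ` with `μ > δ > 0`, then for distinct `u, v ∈ V` the
effective resistances `R_G(u,v) = x u − x v` and `R_{G'}(u,v) = x' u − x' v` (where
`x, x'` are the unique sum-zero solutions of `L·x = χ_{u,v}`, `L'·x' = χ_{u,v}`)
satisfy `|R_G(u,v) − R_{G'}(u,v)| ≤ 4δ·(μ − δ)⁻²`. -/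
theorem effective_resistance_perturbation {V : Type*} [Fintype V] [DecidableEq V]
    (w w' : V → V → ℝ)
    (hsymm : ∀ x y, w x y = w y x) (hsymm' : ∀ x y, w' x y = w' y x)
    (hnonneg : ∀ x y, 0 ≤ w x y) (hnonneg' : ∀ x y, 0 ≤ w' x y)
    (hdiag : ∀ x, w x x = 0) (hdiag' : ∀ x, w' x x = 0)
    (hsub : ∀ x y, w x y = 0 → w' x y = 0)
    (L L' : Matrix V V ℝ)
    (hL : ∀ x y, L x y = (if x = y then ∑ z, w x z else 0) - w x y)
    (hL' : ∀ x y, L' x y = (if x = y then ∑ z, w' x z else 0) - w' x y)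
    (hkerL : ∀ v : V → ℝ, L.mulVec v = 0 ↔ ∃ c : ℝ, v = fun _ => c)
    (hkerL' : ∀ v : V → ℝ, L'.mulVec v = 0 ↔ ∃ c : ℝ, v = fun _ => c)
    (δ μ : ℝ) (hδ : 0 < δ) (hμδ : δ < μ)
    (hF : Real.sqrt (∑ a, ∑ b, (L a b - L' a b) ^ 2) ≤ δ)
    (hlam2 : ∀ v : V → ℝ, (∑ z, v z) = 0 →
      μ * (∑ z, v z ^ 2) ≤ ∑ a, v a * L.mulVec v a)
    (u v : V) (huv : u ≠ v)
    (x x' : V → ℝ)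
    (hx0 : ∑ z, x z = 0) (hx'0 : ∑ z, x' z = 0)
    (hx : L.mulVec x = fun z => if z = u then 1 else if z = v then -1 else 0)
    (hx' : L'.mulVec x' = fun z => if z = u then 1 else if z = v then -1 else 0) :
    |(x u - x v) - (x' u - x' v)| ≤ 4 * δ / (μ - δ) ^ 2 := by
  have hF2 : ∑ a, ∑ b, (L - L') a b ^ 2 ≤ δ ^ 2 := (Real.sqrt_le_left hδ.le).1 hF
  have hsymmL' : L'ᵀ = L' := by
    ext a b
    by_cases h : a = b
    · simp [h]
    · simp [hL', h, Ne.symm h, hsymm' a b]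
  have hX : 0 ≤ ∑ z, x z ^ 2 := Finset.sum_nonneg fun _ _ => sq_nonneg _
  have hX' : 0 ≤ ∑ z, x' z ^ 2 := Finset.sum_nonneg fun _ _ => sq_nonneg _
  have hdiff : ∀ y z : V → ℝ, ∑ a, y a * (L - L').mulVec z a =
      ∑ a, y a * L.mulVec z a - ∑ a, y a * L'.mulVec z a := by
    intro y z
    simp only [Matrix.sub_mulVec, Pi.sub_apply, mul_sub, Finset.sum_sub_distrib]
  have hbound : ∀ y z : V → ℝ, (∑ a, y a * (L - L').mulVec z a) ^ 2 ≤
      δ ^ 2 * ((∑ a, y a ^ 2) * ∑ a, z a ^ 2) := fun y z =>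
    (sq_sum_mul_mulVec_le (L - L') y z).trans <| mul_le_mul_of_nonneg_right hF2 <|
      mul_nonneg (Finset.sum_nonneg fun _ _ => sq_nonneg _)
        (Finset.sum_nonneg fun _ _ => sq_nonneg _)
  have hpair : ∀ y : V → ℝ, ∑ a, y a * L.mulVec x a = y u - y v := fun y => by
    rw [hx]
    exact sum_mul_dipole huv y
  have hpair' : ∀ y : V → ℝ, ∑ a, y a * L'.mulVec x' a = y u - y v := fun y => by
    rw [hx']
    exact sum_mul_dipole huv y
  have hnorm : (μ - δ) ^ 2 * ∑ z, x z ^ 2 ≤ 2 := by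
    refine sq_mul_sum_sq_le_two huv x (by linarith) ?_
    have h := hlam2 x hx0
    rw [hpair] at h
    nlinarith
  have hnorm' : (μ - δ) ^ 2 * ∑ z, x' z ^ 2 ≤ 2 := by
    refine sq_mul_sum_sq_le_two huv x' (by linarith) ?_
    have h := hlam2 x' hx'0
    have hd : ∑ a, x' a * (L - L').mulVec x' a ≤ δ * ∑ z, x' z ^ 2 := by
      refine le_of_abs_le (abs_le_of_sq_le_sq ?_ (mul_nonneg hδ.le hX'))
      calc _ ≤ _ := hbound x' x'
        _ = _ := by ring
    rw [hdiff, hpair'] at hd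
    linarith
  have hR : ∑ a, x' a * (L - L').mulVec x a = -((x u - x v) - (x' u - x' v)) := by
    have hswap : ∑ a, x' a * L'.mulVec x a = ∑ a, x a * L'.mulVec x' a := by
      change x' ⬝ᵥ L' *ᵥ x = x ⬝ᵥ L' *ᵥ x'
      rw [Matrix.dotProduct_mulVec, ← Matrix.mulVec_transpose, hsymmL', dotProduct_comm]
    rw [hdiff, hswap, hpair, hpair']
    ring
  have hmain := hbound x' x
  rw [hR, neg_sq] at hmain
  have hpos : 0 < (μ - δ) ^ 2 := pow_pos (sub_pos.2 hμδ) 2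
  rw [le_div_iff₀ hpos, ← abs_of_pos hpos, ← abs_mul]
  refine abs_le_of_sq_le_sq ?_ (by positivity)
  calc (((x u - x v) - (x' u - x' v)) * (μ - δ) ^ 2) ^ 2
      = ((x u - x v) - (x' u - x' v)) ^ 2 * ((μ - δ) ^ 2) ^ 2 := by ring
    _ ≤ δ ^ 2 * ((∑ z, x' z ^ 2) * ∑ z, x z ^ 2) * ((μ - δ) ^ 2) ^ 2 := by gcongr
    _ = δ ^ 2 * (((μ - δ) ^ 2 * ∑ z, x' z ^ 2) * ((μ - δ) ^ 2 * ∑ z, x z ^ 2)) := by ring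
    _ ≤ δ ^ 2 * (2 * 2) := by gcongr
    _ ≤ (4 * δ) ^ 2 := by nlinarith [sq_nonneg δ]
end

section
/- Let G = (V, E, w) and G' = (V, E', w') be connected finite weighted graphs on the same vertex set with E' ⊆ E, with Laplacians L and L' whose kernels both equal the span of the all-ones vector. Suppose ‖L − L'‖_F ≤ δ and λ₂(L) ≥ μ for some μ > δ > 0, and let d_min = min_{z∈V} deg_G(z) > 0. Define the hitting-time functional h_G(u,v) = (1/2)·Σ_{z∈V} deg_G(z)·(R_G(u,v) + R_G(v,z) − R_G(u,z)) (Tetali's formula), and analogously h_{G'}. Then for every pair of distinct vertices u, v ∈ V: h_G(u,v) − h_{G'}(u,v) ≤ (δ/d_min)·h_G(u,v) + 12δ·(μ − δ)^{-2}·Σ_{e∈E} w_e. -/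
open Finset Matrix

theorem sum_sub_mean_eq_zero {V : Type*} [Fintype V] [Nonempty V] (g : V → ℝ) :
    ∑ z, (g z - (∑ y, g y) / Fintype.card V) = 0 := by
  have : (Fintype.card V : ℝ) ≠ 0 := by exact_mod_cast Fintype.card_ne_zero
  rw [Finset.sum_sub_distrib, Finset.sum_const, Finset.card_univ, nsmul_eq_mul]
  field_simp
  ring

section WeightedLaplacian

variable {V : Type*} [Fintype V] [DecidableEq V]

theorem laplacian_mulVec_apply {w : V → V → ℝ} {L : Matrix V V ℝ}
    (hL : ∀ x y, L x y = (if x = y then ∑ z, w x z else 0) - w x y) (p : V → ℝ) (a : V) :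
    (L *ᵥ p) a = ∑ b, w a b * (p a - p b) := by
  simp only [mulVec, dotProduct, hL, sub_mul, ite_mul, zero_mul, Finset.sum_sub_distrib,
    Finset.sum_ite_eq, Finset.mem_univ, if_true, mul_sub, Finset.sum_mul]

/-- The Dirichlet form of a weighted graph. -/
theorem two_mul_dotProduct_laplacian_mulVec {w : V → V → ℝ} {L : Matrix V V ℝ}
    (hsymm : ∀ x y, w x y = w y x)
    (hL : ∀ x y, L x y = (if x = y then ∑ z, w x z else 0) - w x y) (g p : V → ℝ) :
    2 * (g ⬝ᵥ L *ᵥ p) = ∑ a, ∑ b, w a b * ((g a - g b) * (p a - p b)) := by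
  have h₁ : g ⬝ᵥ L *ᵥ p = ∑ a, ∑ b, w a b * (g a * (p a - p b)) := by
    simp only [dotProduct, laplacian_mulVec_apply hL, Finset.mul_sum]
    exact Finset.sum_congr rfl fun a _ => Finset.sum_congr rfl fun b _ => by ring
  have h₂ : g ⬝ᵥ L *ᵥ p = ∑ a, ∑ b, w a b * (g b * (p b - p a)) := by
    rw [h₁, Finset.sum_comm]
    exact Finset.sum_congr rfl fun a _ => Finset.sum_congr rfl fun b _ => by rw [hsymm]
  rw [two_mul]
  nth_rw 1 [h₁]
  rw [h₂, ← Finset.sum_add_distrib]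
  refine Finset.sum_congr rfl fun a _ => ?_
  rw [← Finset.sum_add_distrib]
  exact Finset.sum_congr rfl fun b _ => by ring

theorem dotProduct_laplacian_mulVec_comm {w : V → V → ℝ} {L : Matrix V V ℝ}
    (hsymm : ∀ x y, w x y = w y x)
    (hL : ∀ x y, L x y = (if x = y then ∑ z, w x z else 0) - w x y) (g p : V → ℝ) :
    g ⬝ᵥ L *ᵥ p = p ⬝ᵥ L *ᵥ g := by
  have h := two_mul_dotProduct_laplacian_mulVec hsymm hL
  have : 2 * (g ⬝ᵥ L *ᵥ p) = 2 * (p ⬝ᵥ L *ᵥ g) := by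
    rw [h, h]
    exact Finset.sum_congr rfl fun a _ => Finset.sum_congr rfl fun b _ => by ring
  linarith

/-- A spectral gap bounds the Dirichlet form below by the variance. -/
theorem mul_sum_sq_sub_mean_le [Nonempty V] {w : V → V → ℝ} {L : Matrix V V ℝ} {μ : ℝ}
    (hsymm : ∀ x y, w x y = w y x)
    (hL : ∀ x y, L x y = (if x = y then ∑ z, w x z else 0) - w x y)
    (hgap : ∀ v : V → ℝ, ∑ z, v z = 0 → μ * ∑ z, v z ^ 2 ≤ v ⬝ᵥ L *ᵥ v) (g : V → ℝ) :
    μ * ∑ z, (g z - (∑ y, g y) / Fintype.card V) ^ 2 ≤ g ⬝ᵥ L *ᵥ g := by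
  have h := hgap _ (sum_sub_mean_eq_zero g)
  have h₁ := two_mul_dotProduct_laplacian_mulVec hsymm hL g g
  have h₂ := two_mul_dotProduct_laplacian_mulVec hsymm hL
    (fun z => g z - (∑ y, g y) / Fintype.card V) (fun z => g z - (∑ y, g y) / Fintype.card V)
  simp only [sub_sub_sub_cancel_right] at h₂
  linarith

/-- Minimum principle: a function superharmonic away from `v` is minimal at `v`. -/
theorem le_of_laplacian_mulVec_nonneg [Nonempty V] {w : V → V → ℝ} {L : Matrix V V ℝ} {μ : ℝ}
    (hsymm : ∀ x y, w x y = w y x) (hnonneg : ∀ x y, 0 ≤ w x y)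
    (hL : ∀ x y, L x y = (if x = y then ∑ z, w x z else 0) - w x y) (hμ : 0 < μ)
    (hgap : ∀ v : V → ℝ, ∑ z, v z = 0 → μ * ∑ z, v z ^ 2 ≤ v ⬝ᵥ L *ᵥ v)
    {p : V → ℝ} {v : V} (hp : ∀ a, a ≠ v → 0 ≤ (L *ᵥ p) a) (z : V) : p v ≤ p z := by
  set g : V → ℝ := fun a => min (p a - p v) 0 with hg
  have hgv : g v = 0 := by simp [hg]
  have hgp : g ⬝ᵥ L *ᵥ p ≤ 0 := by
    refine Finset.sum_nonpos fun a _ => ?_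
    by_cases ha : a = v
    · simp [ha, hgv]
    · exact mul_nonpos_of_nonpos_of_nonneg (min_le_right _ _) (hp a ha)
  have hgg : g ⬝ᵥ L *ᵥ g ≤ g ⬝ᵥ L *ᵥ p := by
    have h₁ := two_mul_dotProduct_laplacian_mulVec hsymm hL g g
    have h₂ := two_mul_dotProduct_laplacian_mulVec hsymm hL g p
    have h₃ : ∑ a, ∑ b, w a b * ((g a - g b) * (g a - g b)) ≤
        ∑ a, ∑ b, w a b * ((g a - g b) * (p a - p b)) := by
      refine Finset.sum_le_sum fun a _ => Finset.sum_le_sum fun b _ =>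
        mul_le_mul_of_nonneg_left ?_ (hnonneg a b)
      simp only [hg]
      rcases min_cases (p a - p v) 0 with ⟨h, h'⟩ | ⟨h, h'⟩ <;>
        rcases min_cases (p b - p v) 0 with ⟨k, k'⟩ | ⟨k, k'⟩ <;> rw [h, k] <;> nlinarith
    linarith
  have hvar := mul_sum_sq_sub_mean_le hsymm hL hgap g
  have hzero : ∑ z, (g z - (∑ y, g y) / Fintype.card V) ^ 2 ≤ 0 := by
    by_contra! h
    nlinarith [mul_pos hμ h]
  have hmean : ∀ a, g a = (∑ y, g y) / Fintype.card V := fun a => by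
    have := Finset.single_le_sum (f := fun z => (g z - (∑ y, g y) / Fintype.card V) ^ 2)
      (fun i _ => sq_nonneg _) (Finset.mem_univ a)
    have h0 : (g a - (∑ y, g y) / Fintype.card V) ^ 2 = 0 :=
      le_antisymm (this.trans hzero) (sq_nonneg _)
    exact sub_eq_zero.mp (pow_eq_zero_iff two_ne_zero |>.mp h0)
  have hgz : g z = 0 := by rw [hmean z, ← hmean v, hgv]
  have := min_eq_right_iff.mp hgz
  linarith

theorem half_mul_le_degree {w : V → V → ℝ} {L : Matrix V V ℝ} {μ : ℝ}
    (hsymm : ∀ x y, w x y = w y x) (hdiag : ∀ x, w x x = 0)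
    (hL : ∀ x y, L x y = (if x = y then ∑ z, w x z else 0) - w x y) (hμ : 0 ≤ μ)
    (hgap : ∀ v : V → ℝ, ∑ z, v z = 0 → μ * ∑ z, v z ^ 2 ≤ v ⬝ᵥ L *ᵥ v) [Nontrivial V]
    (z : V) : μ / 2 ≤ ∑ y, w z y := by
  have h := mul_sum_sq_sub_mean_le hsymm hL hgap (Pi.single z 1)
  have hcard : (2 : ℝ) ≤ Fintype.card V := by exact_mod_cast Fintype.one_lt_card (α := V)
  have hsum : ∑ y, (Pi.single z 1 : V → ℝ) y = 1 := by simp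
  have hval : ∑ y, ((Pi.single z 1 : V → ℝ) y - 1 / Fintype.card V) ^ 2 =
      1 - 1 / (Fintype.card V : ℝ) := by
    have : ∀ y, ((Pi.single z 1 : V → ℝ) y - 1 / Fintype.card V) ^ 2 =
        (1 - 2 / (Fintype.card V : ℝ)) * (Pi.single z 1 : V → ℝ) y +
          1 / (Fintype.card V : ℝ) ^ 2 := by
      intro y
      by_cases hy : y = z
      · subst hy; simp; ring
      · simp [hy]
    simp only [this, Finset.sum_add_distrib, ← Finset.mul_sum, hsum, Finset.sum_const,
      Finset.card_univ, nsmul_eq_mul]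
    field_simp
    ring
  have hform : (Pi.single z 1 : V → ℝ) ⬝ᵥ L *ᵥ Pi.single z 1 = ∑ y, w z y := by
    simp [hL, hdiag]
  rw [hsum, hval, hform] at h
  have : (1 : ℝ) / Fintype.card V ≤ 1 / 2 := one_div_le_one_div_of_le two_pos hcard
  nlinarith

end WeightedLaplacian

section Perturbation

variable {V : Type*} [Fintype V]

theorem sq_dotProduct_mulVec_le (M : Matrix V V ℝ) (x y : V → ℝ) :
    (x ⬝ᵥ M *ᵥ y) ^ 2 ≤ (∑ a, ∑ b, M a b ^ 2) * ((∑ z, x z ^ 2) * ∑ z, y z ^ 2) := by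
  have h₁ : (x ⬝ᵥ M *ᵥ y) ^ 2 ≤ (∑ z, x z ^ 2) * ∑ a, (M *ᵥ y) a ^ 2 :=
    Finset.sum_mul_sq_le_sq_mul_sq _ _ _
  have h₂ : ∑ a, (M *ᵥ y) a ^ 2 ≤ (∑ a, ∑ b, M a b ^ 2) * ∑ z, y z ^ 2 := by
    rw [Finset.sum_mul]
    exact Finset.sum_le_sum fun a _ => Finset.sum_mul_sq_le_sq_mul_sq _ _ _
  calc _ ≤ _ := h₁
    _ ≤ (∑ z, x z ^ 2) * ((∑ a, ∑ b, M a b ^ 2) * ∑ z, y z ^ 2) :=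
      mul_le_mul_of_nonneg_left h₂ (Finset.sum_nonneg fun _ _ => sq_nonneg _)
    _ = _ := by ring

theorem abs_dotProduct_mulVec_le {M : Matrix V V ℝ} {δ s t : ℝ} {x y : V → ℝ} (hδ : 0 ≤ δ)
    (hM : ∑ a, ∑ b, M a b ^ 2 ≤ δ ^ 2) (hs : 0 ≤ s) (ht : 0 ≤ t)
    (hx : ∑ z, x z ^ 2 ≤ s ^ 2) (hy : ∑ z, y z ^ 2 ≤ t ^ 2) :
    |x ⬝ᵥ M *ᵥ y| ≤ δ * (s * t) := by
  refine abs_le_of_sq_le_sq ?_ (by positivity)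
  calc _ ≤ _ := sq_dotProduct_mulVec_le M x y
    _ ≤ δ ^ 2 * (s ^ 2 * t ^ 2) := by gcongr
    _ = _ := by ring

/-- A perturbation of Frobenius norm at most `δ` lowers the spectral gap by at most `δ`. -/
theorem spectral_gap_sub_le {L L' : Matrix V V ℝ} {δ μ : ℝ} (hδ : 0 ≤ δ)
    (hF : ∑ a, ∑ b, (L - L') a b ^ 2 ≤ δ ^ 2)
    (hgap : ∀ v : V → ℝ, ∑ z, v z = 0 → μ * ∑ z, v z ^ 2 ≤ v ⬝ᵥ L *ᵥ v)
    (v : V → ℝ) (hv : ∑ z, v z = 0) : (μ - δ) * ∑ z, v z ^ 2 ≤ v ⬝ᵥ L' *ᵥ v := by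
  have hS : 0 ≤ ∑ z, v z ^ 2 := Finset.sum_nonneg fun _ _ => sq_nonneg _
  have hsq := (Real.sq_sqrt hS).ge
  have h := abs_dotProduct_mulVec_le hδ hF (Real.sqrt_nonneg _) (Real.sqrt_nonneg _) hsq hsq
  rw [Real.mul_self_sqrt hS, sub_mulVec, dotProduct_sub] at h
  linarith [le_abs_self (v ⬝ᵥ L *ᵥ v - v ⬝ᵥ L' *ᵥ v), hgap v hv]

variable [DecidableEq V]

theorem dotProduct_dipole {a b : V} (hab : a ≠ b) (y : V → ℝ) :
    (y ⬝ᵥ fun z => if z = a then 1 else if z = b then -1 else 0) = y a - y b := by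
  have : (fun z => if z = a then (1 : ℝ) else if z = b then -1 else 0) =
      Pi.single a 1 - Pi.single b 1 := by
    ext z
    by_cases h₁ : z = a
    · subst h₁; simp [hab]
    · by_cases h₂ : z = b
      · subst h₂; simp [h₁]
      · simp [h₁, h₂]
  rw [this, dotProduct_sub, dotProduct_single_one, dotProduct_single_one]

/-- The norm of the potential of a unit current is controlled by the spectral gap. -/
theorem sum_sq_potential_le {L : Matrix V V ℝ} {c : ℝ} (hc : 0 < c)
    (hgap : ∀ v : V → ℝ, ∑ z, v z = 0 → c * ∑ z, v z ^ 2 ≤ v ⬝ᵥ L *ᵥ v)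
    {a b : V} (hab : a ≠ b) {x : V → ℝ} (hx : ∑ z, x z = 0)
    (hLx : L *ᵥ x = fun z => if z = a then 1 else if z = b then -1 else 0) :
    ∑ z, x z ^ 2 ≤ (√2 / c) ^ 2 := by
  have h := hgap x hx
  rw [hLx, dotProduct_dipole hab] at h
  have hpair : x a ^ 2 + x b ^ 2 ≤ ∑ z, x z ^ 2 := by
    rw [← Finset.sum_pair (f := fun z => x z ^ 2) hab]
    exact Finset.sum_le_sum_of_subset_of_nonneg (Finset.subset_univ _) fun _ _ _ => sq_nonneg _
  set S := ∑ z, x z ^ 2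
  have hS : 0 ≤ S := by nlinarith [sq_nonneg (x a), sq_nonneg (x b)]
  have hsq : (c * S) ^ 2 ≤ 2 * S := by
    have : (c * S) ^ 2 ≤ (x a - x b) ^ 2 := pow_le_pow_left₀ (by positivity) h 2
    nlinarith [sq_nonneg (x a + x b)]
  rw [div_pow, Real.sq_sqrt zero_le_two, le_div_iff₀ (by positivity)]
  rcases hS.eq_or_lt with h0 | hpos
  · rw [← h0]; norm_num
  · nlinarith

/-- Effective resistances of two Laplacians at Frobenius distance at most `δ`. -/
theorem abs_resistance_sub_le {w' : V → V → ℝ} {L L' : Matrix V V ℝ} {δ μ : ℝ}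
    (hsymm' : ∀ x y, w' x y = w' y x)
    (hL' : ∀ x y, L' x y = (if x = y then ∑ z, w' x z else 0) - w' x y)
    (hδ : 0 ≤ δ) (hμδ : δ < μ) (hF : ∑ a, ∑ b, (L - L') a b ^ 2 ≤ δ ^ 2)
    (hgap : ∀ v : V → ℝ, ∑ z, v z = 0 → μ * ∑ z, v z ^ 2 ≤ v ⬝ᵥ L *ᵥ v)
    {a b : V} (hab : a ≠ b) {x x' : V → ℝ} (hx : ∑ z, x z = 0) (hx' : ∑ z, x' z = 0)
    (hLx : L *ᵥ x = fun z => if z = a then 1 else if z = b then -1 else 0)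
    (hLx' : L' *ᵥ x' = fun z => if z = a then 1 else if z = b then -1 else 0) :
    |(x a - x b) - (x' a - x' b)| ≤ 2 * δ / (μ * (μ - δ)) := by
  have hμ : 0 < μ := hδ.trans_lt hμδ
  have hd : 0 < μ - δ := sub_pos.mpr hμδ
  have h := abs_dotProduct_mulVec_le hδ hF (by positivity) (by positivity)
    (sum_sq_potential_le hd (spectral_gap_sub_le hδ hF hgap) hab hx' hLx')
    (sum_sq_potential_le hμ hgap hab hx hLx)
  rw [sub_mulVec, dotProduct_sub, dotProduct_laplacian_mulVec_comm hsymm' hL' x' x, hLx, hLx',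
    dotProduct_dipole hab, dotProduct_dipole hab, abs_sub_comm] at h
  convert h using 1
  have := Real.mul_self_sqrt (zero_le_two (α := ℝ))
  field_simp
  linear_combination -δ * this

/-- The summand of Tetali's formula is nonnegative. -/
theorem resistance_triangle [Nonempty V] {w : V → V → ℝ} {L : Matrix V V ℝ} {μ : ℝ}
    (hsymm : ∀ x y, w x y = w y x) (hnonneg : ∀ x y, 0 ≤ w x y)
    (hL : ∀ x y, L x y = (if x = y then ∑ z, w x z else 0) - w x y)
    (hker : ∀ v : V → ℝ, L *ᵥ v = 0 ↔ ∃ c : ℝ, v = fun _ => c) (hμ : 0 < μ)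
    (hgap : ∀ v : V → ℝ, ∑ z, v z = 0 → μ * ∑ z, v z ^ 2 ≤ v ⬝ᵥ L *ᵥ v)
    {R : V → V → ℝ} (hRdiag : ∀ u, R u u = 0)
    (hR : ∀ u v, u ≠ v → ∃ x : V → ℝ, ∑ z, x z = 0 ∧
      L *ᵥ x = (fun z => if z = u then 1 else if z = v then -1 else 0) ∧ R u v = x u - x v)
    {u v : V} (huv : u ≠ v) (z : V) : 0 ≤ R u v + R v z - R u z := by
  have hmin {p : V → ℝ} {v : V} := le_of_laplacian_mulVec_nonneg hsymm hnonneg hL hμ hgap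
    (p := p) (v := v)
  have hsink : ∀ {a b : V} {p : V → ℝ},
      L *ᵥ p = (fun z => if z = a then 1 else if z = b then -1 else 0) → ∀ z, p b ≤ p z :=
    fun {a b p} hp => hmin fun c hc => by
      rw [hp]
      simp only [hc, if_false]
      split_ifs <;> norm_num
  by_cases hvz : v = z
  · subst hvz; simp [hRdiag]
  obtain ⟨p, -, hLp, hRp⟩ := hR u v huv
  obtain ⟨q, -, hLq, hRq⟩ := hR v z hvz
  by_cases huz : u = z
  · subst huz
    rw [hRdiag, hRp, hRq]
    linarith [hsink hLp u, hsink hLq v]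
  obtain ⟨r, -, hLr, hRr⟩ := hR u z huz
  have hsource : q u ≤ q v := by
    have h : (-q) v ≤ (-q) u := hmin (fun c hc => by
      rw [mulVec_neg, hLq]
      simp only [Pi.neg_apply, hc, if_false]
      split_ifs <;> norm_num) u
    simpa using h
  obtain ⟨c, hc⟩ := (hker (p + q - r)).mp (by
    rw [mulVec_sub, mulVec_add, hLp, hLq, hLr]
    ext y
    simp only [Pi.add_apply, Pi.sub_apply, Pi.zero_apply]
    split_ifs <;> simp_all)
  have hcu := congrFun hc u
  have hcz := congrFun hc z
  simp only [Pi.add_apply, Pi.sub_apply] at hcu hcz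
  rw [hRp, hRq, hRr]
  linarith [hsink hLp z]

end Perturbation

/-- **Hitting time perturbation under Laplacian sparsification (Theorem 5 of the
paper).**
Let `G = (V,E,w)` and `G' = (V,E',w')` be connected weighted graphs on the same
finite vertex set with `E' ⊆ E`, with Laplacians `L, L'` whose kernels both equal the
span of the all-ones vector. Assume `‖L − L'‖_F ≤ δ` and `λ₂(L) ≥ μ` (expressed as
`μ‖v‖² ≤ vᵀLv` for sum-zero `v`) with `μ > δ > 0`, and let `dmin = min_z deg_G(z) > 0`.
With effective resistances `RG, RG'` (`RG u v = x u − x v` for the unique sum-zero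
solution of `L·x = χ_{u,v}`, and `RG u u = 0`) and the hitting-time functionals
`h_G(u,v) = (1/2)·∑_z deg_G(z)·(RG u v + RG v z − RG u z)` (Tetali's formula) and
analogously `h_{G'}`, every pair of distinct vertices `u, v` satisfies
`h_G(u,v) − h_{G'}(u,v) ≤ (δ/dmin)·h_G(u,v) + 12δ·(μ−δ)⁻²·∑_{e∈E} w_e`, where the
total edge weight is `∑_{e∈E} w_e = (1/2)·∑_{x,y} w x y`. -/
theorem hitting_time_perturbation {V : Type*} [Fintype V] [DecidableEq V] [Nonempty V]
    (w w' : V → V → ℝ)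
    (hsymm : ∀ x y, w x y = w y x) (hsymm' : ∀ x y, w' x y = w' y x)
    (hnonneg : ∀ x y, 0 ≤ w x y) (hnonneg' : ∀ x y, 0 ≤ w' x y)
    (hdiag : ∀ x, w x x = 0) (hdiag' : ∀ x, w' x x = 0)
    (hsub : ∀ x y, w x y = 0 → w' x y = 0)
    (L L' : Matrix V V ℝ)
    (hL : ∀ x y, L x y = (if x = y then ∑ z, w x z else 0) - w x y)
    (hL' : ∀ x y, L' x y = (if x = y then ∑ z, w' x z else 0) - w' x y)
    (hkerL : ∀ v : V → ℝ, L.mulVec v = 0 ↔ ∃ c : ℝ, v = fun _ => c)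
    (hkerL' : ∀ v : V → ℝ, L'.mulVec v = 0 ↔ ∃ c : ℝ, v = fun _ => c)
    (δ μ : ℝ) (hδ : 0 < δ) (hμδ : δ < μ)
    (hF : Real.sqrt (∑ a, ∑ b, (L a b - L' a b) ^ 2) ≤ δ)
    (hlam2 : ∀ v : V → ℝ, (∑ z, v z) = 0 →
      μ * (∑ z, v z ^ 2) ≤ ∑ a, v a * L.mulVec v a)
    (dmin : ℝ)
    (hdmin : dmin = Finset.univ.inf' Finset.univ_nonempty (fun z => ∑ y, w z y))
    (hdminpos : 0 < dmin)
    (RG RG' : V → V → ℝ)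
    (hRGdiag : ∀ u, RG u u = 0) (hRG'diag : ∀ u, RG' u u = 0)
    (hRG : ∀ u v, u ≠ v → ∃ x : V → ℝ, (∑ z, x z) = 0 ∧
      L.mulVec x = (fun z => if z = u then 1 else if z = v then -1 else 0) ∧
      RG u v = x u - x v)
    (hRG' : ∀ u v, u ≠ v → ∃ x : V → ℝ, (∑ z, x z) = 0 ∧
      L'.mulVec x = (fun z => if z = u then 1 else if z = v then -1 else 0) ∧
      RG' u v = x u - x v)
    (hG hG' : V → V → ℝ)
    (hhG : ∀ u v, hG u v =
      (1 / 2) * ∑ z, (∑ y, w z y) * (RG u v + RG v z - RG u z))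
    (hhG' : ∀ u v, hG' u v =
      (1 / 2) * ∑ z, (∑ y, w' z y) * (RG' u v + RG' v z - RG' u z))
    (u v : V) (huv : u ≠ v) :
    hG u v - hG' u v ≤
      (δ / dmin) * hG u v +
        12 * δ / (μ - δ) ^ 2 * ((1 / 2) * ∑ x, ∑ y, w x y) := by
  have hμ : 0 < μ := hδ.trans hμδ
  have hd : 0 < μ - δ := sub_pos.mpr hμδ
  have : Nontrivial V := ⟨u, v, huv⟩
  have hF' : ∑ a, ∑ b, (L - L') a b ^ 2 ≤ δ ^ 2 := (Real.sqrt_le_left hδ.le).mp hF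
  have hgap : ∀ v : V → ℝ, ∑ z, v z = 0 → μ * ∑ z, v z ^ 2 ≤ v ⬝ᵥ L *ᵥ v := hlam2
  have hdeg : ∀ z, |(∑ y, w z y) - ∑ y, w' z y| ≤ δ := fun z => by
    refine abs_le_of_sq_le_sq ?_ hδ.le
    calc ((∑ y, w z y) - ∑ y, w' z y) ^ 2 = (L - L') z z ^ 2 := by
          simp [hL, hL', hdiag, hdiag']
      _ ≤ ∑ b, (L - L') z b ^ 2 :=
          Finset.single_le_sum (f := fun b => (L - L') z b ^ 2) (fun _ _ => sq_nonneg _)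
            (Finset.mem_univ z)
      _ ≤ ∑ a, ∑ b, (L - L') a b ^ 2 :=
          Finset.single_le_sum (f := fun a => ∑ b, (L - L') a b ^ 2)
            (fun _ _ => Finset.sum_nonneg fun _ _ => sq_nonneg _) (Finset.mem_univ z)
      _ ≤ δ ^ 2 := hF'
  have hres : ∀ a b, |RG a b - RG' a b| ≤ 2 * δ / (μ * (μ - δ)) := fun a b => by
    by_cases hab : a = b
    · subst hab
      rw [hRGdiag, hRG'diag, sub_zero, abs_zero]
      positivity
    obtain ⟨x, hx, hLx, hRx⟩ := hRG a b hab
    obtain ⟨x', hx', hLx', hRx'⟩ := hRG' a b hab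
    rw [hRx, hRx']
    exact abs_resistance_sub_le hsymm' hL' hδ.le hμδ hF' hgap hab hx hx' hLx hLx'
  have hterm : ∀ z, (∑ y, w z y) * (RG u v + RG v z - RG u z) -
      (∑ y, w' z y) * (RG' u v + RG' v z - RG' u z) ≤
      δ / dmin * ((∑ y, w z y) * (RG u v + RG v z - RG u z)) +
        12 * δ / (μ - δ) ^ 2 * ∑ y, w z y := fun z => by
    have htri := resistance_triangle hsymm hnonneg hL hkerL hμ hgap hRGdiag hRG huv z
    have hmin : dmin ≤ ∑ y, w z y := hdmin ▸ Finset.inf'_le _ (Finset.mem_univ z)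
    have hhalf := half_mul_le_degree hsymm hdiag hL hμ.le hgap z
    have hdeg'_nonneg : 0 ≤ ∑ y, w' z y := Finset.sum_nonneg fun y _ => hnonneg' z y
    have hdz := abs_le.mp (hdeg z)
    have huv' := abs_le.mp (hres u v)
    have hvz' := abs_le.mp (hres v z)
    have huz' := abs_le.mp (hres u z)
    set D := ∑ y, w z y
    set D' := ∑ y, w' z y
    set T := RG u v + RG v z - RG u z
    set T' := RG' u v + RG' v z - RG' u z
    have hTT' : T - T' ≤ 6 * δ / (μ * (μ - δ)) := by
      rw [show 6 * δ / (μ * (μ - δ)) = 3 * (2 * δ / (μ * (μ - δ))) by ring]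
      simp only [T, T']
      linarith
    have hratio : D' * (μ - δ) ≤ 2 * μ * D := by
      nlinarith [mul_nonneg hd.le (sub_nonneg.mpr hhalf), mul_nonneg hδ.le (sub_nonneg.mpr hhalf)]
    have hfirst : (D - D') * T ≤ δ / dmin * (D * T) := by
      have : D - D' ≤ δ / dmin * D := by
        rw [div_mul_eq_mul_div, le_div_iff₀ hdminpos]
        nlinarith
      nlinarith
    have hsecond : D' * (T - T') ≤ 12 * δ / (μ - δ) ^ 2 * D :=
      calc D' * (T - T') ≤ D' * (6 * δ / (μ * (μ - δ))) := by gcongr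
        _ = D' * (μ - δ) * (6 * δ / (μ * (μ - δ) ^ 2)) := by field_simp
        _ ≤ 2 * μ * D * (6 * δ / (μ * (μ - δ) ^ 2)) := by gcongr
        _ = 12 * δ / (μ - δ) ^ 2 * D := by field_simp; ring
    linarith
  have hsum := Finset.sum_le_sum fun z (_ : z ∈ Finset.univ) => hterm z
  rw [Finset.sum_sub_distrib, Finset.sum_add_distrib, ← Finset.mul_sum, ← Finset.mul_sum] at hsum
  rw [hhG, hhG']
  linarith
end
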